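/- Theorem 1 (principled step-level policy gradient, with prompt and state mixtures): for every Z ≥ 1, ∑_{q ∈ Q} p q • ∑_{s ∈ S} d q s • ∑_{v : Fin Z → A} P_s(v) • ((1/Z) ∑_{z : Fin Z} (ρ_s (v z) * (R q s (v z) − R̄_{q,s}(v))) • D_{s, v z}) = ((Z − 1)/Z) • fderiv ℝ J_t θ₀, where J_t θ = ∑_{q} p q * ∑_{s} d q s * ∑_{a} π θ s a * R q s a. Thus the expected negative gradient of the step-wise loss, taken over prompts q ∼ p, states s ∼ d(q) (the θ-independent state distribution induced by the frozen behavior model), and Z branched actions sampled i.i.d. from the behavior policy π θ_old(·|s), equals (Z−1)/Z times the policy gradient of the fixed-state objective J_t. -/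

import Mathlib

/-- The expectation of a function of one coordinate under a product of probability weights. -/
theorem sum_prod_mul_apply {ι A : Type*} [Fintype ι] [DecidableEq ι] [Fintype A]
    (μ : A → ℝ)
    (hμ : ∑ a, μ a = 1) (g : A → ℝ) (z : ι) :
    ∑ v : ι → A, (∏ i, μ (v i)) * g (v z) = ∑ a, μ a * g a := by
  have h (v : ι → A) :
      (∏ i, μ (v i)) * g (v z) = ∏ i, μ (v i) * (if i = z then g (v i) else 1) := by
    rw [Finset.prod_mul_distrib, Finset.prod_ite_eq' Finset.univ z, if_pos (Finset.mem_univ z)]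
  simp_rw [h]
  rw [← Fintype.prod_sum (fun i a => μ a * (if i = z then g a else 1)),
    Finset.prod_eq_single z (fun i _ hi => by simp [hi, hμ]) (by simp)]
  simp

/-- Under a product of probability weights, functions of two distinct coordinates are
uncorrelated. -/
theorem sum_prod_mul_apply_mul_apply {ι A : Type*} [Fintype ι] [DecidableEq ι] [Fintype A]
    (μ : A → ℝ)
    (hμ : ∑ a, μ a = 1) (g h : A → ℝ) {z j : ι} (hzj : z ≠ j) :
    ∑ v : ι → A, (∏ i, μ (v i)) * (g (v z) * h (v j)) =
      (∑ a, μ a * g a) * ∑ a, μ a * h a := by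
  have e (v : ι → A) : (∏ i, μ (v i)) * (g (v z) * h (v j)) =
      ∏ i, μ (v i) * ((if i = z then g (v i) else 1) * (if i = j then h (v i) else 1)) := by
    rw [Finset.prod_mul_distrib, Finset.prod_mul_distrib, Finset.prod_ite_eq' Finset.univ z,
      Finset.prod_ite_eq' Finset.univ j, if_pos (Finset.mem_univ z), if_pos (Finset.mem_univ j)]
  simp_rw [e]
  rw [← Fintype.prod_sum
      (fun i a => μ a * ((if i = z then g a else 1) * (if i = j then h a else 1))),
    Finset.prod_eq_mul z j hzj (fun i _ hi => by simp [hi.1, hi.2, hμ]) (by simp) (by simp)]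
  simp [hzj, hzj.symm]

/-- Centering `R` by its sample mean scales its expected product with a mean-zero `h` by
`(Z - 1) / Z`. -/
theorem sum_prod_mul_centered {A : Type*} [Fintype A] (μ : A → ℝ) (hμ : ∑ a, μ a = 1)
    (h R : A → ℝ) (hh : ∑ a, μ a * h a = 0) {Z : ℕ} (hZ : Z ≠ 0) :
    ∑ v : Fin Z → A, (∏ i, μ (v i)) *
        (1 / (Z : ℝ) * ∑ z, h (v z) * (R (v z) - 1 / (Z : ℝ) * ∑ j, R (v j))) =
      ((Z : ℝ) - 1) / Z * ∑ a, μ a * (h a * R a) := by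
  have hZ' : (Z : ℝ) ≠ 0 := Nat.cast_ne_zero.mpr hZ
  have cross (z j : Fin Z) : ∑ v : Fin Z → A, (∏ i, μ (v i)) * (h (v z) * R (v j)) =
      if j = z then ∑ a, μ a * (h a * R a) else 0 := by
    split_ifs with hj
    · subst hj
      exact sum_prod_mul_apply μ hμ (fun a => h a * R a) j
    · rw [sum_prod_mul_apply_mul_apply μ hμ h R (Ne.symm hj), hh, zero_mul]
  have expand (v : Fin Z → A) : (∏ i, μ (v i)) *
        (1 / (Z : ℝ) * ∑ z, h (v z) * (R (v z) - 1 / (Z : ℝ) * ∑ j, R (v j))) =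
      1 / (Z : ℝ) * ∑ z, ((∏ i, μ (v i)) * (h (v z) * R (v z)) -
        1 / (Z : ℝ) * ∑ j, (∏ i, μ (v i)) * (h (v z) * R (v j))) := by
    rw [mul_left_comm, Finset.mul_sum]
    congr 1
    refine Finset.sum_congr rfl fun z _ => ?_
    rw [← Finset.mul_sum, ← Finset.mul_sum]
    ring
  simp_rw [expand]
  rw [← Finset.mul_sum, Finset.sum_comm]
  have sample_mean (z : Fin Z) :
      ∑ v : Fin Z → A, 1 / (Z : ℝ) * ∑ j, (∏ i, μ (v i)) * (h (v z) * R (v j)) =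
        1 / (Z : ℝ) * ∑ a, μ a * (h a * R a) := by
    rw [← Finset.mul_sum, Finset.sum_comm]
    simp [cross]
  simp only [Finset.sum_sub_distrib, sample_mean, cross, if_true, Finset.sum_const, Finset.card_univ,
    Fintype.card_fin, nsmul_eq_mul]
  field_simp

/-- The score of a policy that does not vanish at `θ₀` has mean zero. -/
theorem sum_smul_fderiv_log_eq_zero {E A : Type*} [NormedAddCommGroup E] [NormedSpace ℝ E]
    [Fintype A] (f : E → A → ℝ) (θ₀ : E) (hne : ∀ a, f θ₀ a ≠ 0)
    (hsum : ∀ θ, ∑ a, f θ a = 1) (hdiff : ∀ a, DifferentiableAt ℝ (fun θ => f θ a) θ₀) :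
    ∑ a, f θ₀ a • fderiv ℝ (fun θ => Real.log (f θ a)) θ₀ = 0 := by
  calc
    _ = ∑ a, fderiv ℝ (fun θ => f θ a) θ₀ :=
      Finset.sum_congr rfl fun a _ => by
        rw [fderiv.log (hdiff a) (hne a), smul_inv_smul₀ (hne a)]
    _ = fderiv ℝ (fun θ => ∑ a, f θ a) θ₀ := (fderiv_fun_sum fun a _ => hdiff a).symm
    _ = 0 := by simp [hsum]


/-- Theorem 1 (principled step-level policy gradient, with prompt and state mixtures):
the expected negative gradient of the step-wise loss, taken over prompts `q ∼ p`, states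
`s ∼ d q`, and `Z` branched actions sampled i.i.d. from the behavior policy `π θold (· | s)`,
equals `(Z-1)/Z` times the policy gradient of the fixed-state objective `J_t` at `θ₀`. -/
theorem step_level_policy_gradient
    {E : Type*} [NormedAddCommGroup E] [NormedSpace ℝ E]
    {Q S A : Type*} [Fintype Q] [Nonempty Q] [Fintype S] [Nonempty S]
    [Fintype A] [Nonempty A]
    (π : E → S → A → ℝ) (θ₀ θold : E)
    (p : Q → ℝ) (d : Q → S → ℝ) (R : Q → S → A → ℝ)
    (hp : ∀ q, 0 ≤ p q) (hpsum : ∑ q, p q = 1)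
    (hd : ∀ q s, 0 ≤ d q s) (hdsum : ∀ q, ∑ s, d q s = 1)
    (hpos : ∀ θ s a, 0 < π θ s a)
    (hsum : ∀ θ s, ∑ a, π θ s a = 1)
    (hdiff : ∀ s a, DifferentiableAt ℝ (fun θ => π θ s a) θ₀)
    (Z : ℕ) (hZ : 1 ≤ Z) :
    ∑ q, p q •
      ∑ s, d q s •
        ∑ v : Fin Z → A,
          (∏ i, π θold s (v i)) •
            ((1 / (Z : ℝ)) •
              ∑ z : Fin Z,
                ((π θ₀ s (v z) / π θold s (v z)) *
                    (R q s (v z) - (1 / (Z : ℝ)) * ∑ j : Fin Z, R q s (v j))) •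
                  fderiv ℝ (fun θ => Real.log (π θ s (v z))) θ₀)
      = (((Z : ℝ) - 1) / (Z : ℝ)) •
          fderiv ℝ (fun θ => ∑ q, p q * ∑ s, d q s * ∑ a, π θ s a * R q s a) θ₀ := by
  have grad : fderiv ℝ (fun θ => ∑ q, p q * ∑ s, d q s * ∑ a, π θ s a * R q s a) θ₀ =
      ∑ q, p q • ∑ s, d q s • ∑ a, R q s a • fderiv ℝ (fun θ => π θ s a) θ₀ :=
    (HasFDerivAt.fun_sum fun q _ => (HasFDerivAt.fun_sum fun s _ =>
      (HasFDerivAt.fun_sum fun a _ =>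
        (hdiff s a).hasFDerivAt.mul_const (R q s a)).const_mul (d q s)).const_mul (p q)).fderiv
  rw [grad, Finset.smul_sum]
  refine Finset.sum_congr rfl fun q _ => ?_
  rw [smul_comm]
  congr 1
  rw [Finset.smul_sum]
  refine Finset.sum_congr rfl fun s _ => ?_
  rw [smul_comm]
  congr 1
  ext x
  have score (a : A) : π θold s a *
      (π θ₀ s a / π θold s a * fderiv ℝ (fun θ => Real.log (π θ s a)) θ₀ x) =
      π θ₀ s a * fderiv ℝ (fun θ => Real.log (π θ s a)) θ₀ x := by
    rw [← mul_assoc, mul_div_cancel₀ _ (hpos θold s a).ne']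
  have mean_zero := congrArg (fun L : E →L[ℝ] ℝ => L x)
    (sum_smul_fderiv_log_eq_zero (fun θ a => π θ s a) θ₀ (fun a => (hpos θ₀ s a).ne')
      (fun θ => hsum θ s) (hdiff s))
  have key := sum_prod_mul_centered (π θold s) (hsum θold s)
    (fun a => π θ₀ s a / π θold s a * fderiv ℝ (fun θ => Real.log (π θ s a)) θ₀ x)
    (R q s) (by simpa [score] using mean_zero) (Nat.one_le_iff_ne_zero.mp hZ)
  simp only [sum_apply, smul_apply, smul_eq_mul]
  simp only [mul_right_comm (π θ₀ s _ / π θold s _)]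
  refine key.trans ?_
  congr 1
  refine Finset.sum_congr rfl fun a _ => ?_
  rw [← mul_assoc, score, fderiv.log (hdiff s a) (hpos θ₀ s a).ne',
    smul_apply, smul_eq_mul, mul_inv_cancel_left₀ (hpos θ₀ s a).ne',
    mul_comm]
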